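/- For every natural number n ≥ 2, the coefficient of X² in ascPochhammer ℚ n equals (n-1)! · ∑_{i=1}^{n-1} 1/i, and the coefficient of X³ in ascPochhammer ℚ n equals ((n-1)!/2) · ( (∑_{i=1}^{n-1} 1/i)² − ∑_{i=1}^{n-1} 1/i² ). -/

import Mathlib

open Finset

theorem ascPochhammer_succ_coeff_succ {S : Type*} [Semiring S] (n k : ℕ) :
    (ascPochhammer S (n + 1)).coeff (k + 1) =
      (ascPochhammer S n).coeff k + (ascPochhammer S n).coeff (k + 1) * n := by
  rw [ascPochhammer_succ_right, mul_add, Polynomial.coeff_add, Polynomial.coeff_mul_X,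
    Polynomial.coeff_mul_natCast]

theorem ascPochhammer_succ_coeff_one {S : Type*} [Semiring S] (n : ℕ) :
    (ascPochhammer S (n + 1)).coeff 1 = (n.factorial : S) := by
  induction n with
  | zero => simp
  | succ n ih =>
    rw [ascPochhammer_succ_coeff_succ, ih, Polynomial.coeff_zero_eq_eval_zero,
      ascPochhammer_ne_zero_eval_zero _ n.succ_ne_zero, zero_add, Nat.factorial_succ,
      mul_comm (n + 1), Nat.cast_mul]

theorem ascPochhammer_succ_coeff_two (n : ℕ) :
    (ascPochhammer ℚ (n + 1)).coeff 2 =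
      (n.factorial : ℚ) * ∑ i ∈ Finset.Icc 1 n, (1 : ℚ) / i := by
  induction n with
  | zero => simp [Polynomial.coeff_X]
  | succ n ih =>
    rw [ascPochhammer_succ_coeff_succ, ih, ascPochhammer_succ_coeff_one,
      Finset.sum_Icc_succ_top (by lia), Nat.factorial_succ]
    push_cast
    field_simp
    ring

theorem ascPochhammer_succ_coeff_three (n : ℕ) :
    (ascPochhammer ℚ (n + 1)).coeff 3 =
      ((n.factorial : ℚ) / 2) * ((∑ i ∈ Finset.Icc 1 n, (1 : ℚ) / i) ^ 2 -
        ∑ i ∈ Finset.Icc 1 n, (1 : ℚ) / (i : ℚ) ^ 2) := by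
  induction n with
  | zero => simp [Polynomial.coeff_X]
  | succ n ih =>
    rw [ascPochhammer_succ_coeff_succ, ih, ascPochhammer_succ_coeff_two,
      Finset.sum_Icc_succ_top (by lia), Finset.sum_Icc_succ_top (by lia), Nat.factorial_succ]
    push_cast
    field_simp
    ring

/-- For `n ≥ 2`, the coefficient of `X²` in `ascPochhammer ℚ n` equals
`(n-1)! ∑_{i=1}^{n-1} 1/i`, and the coefficient of `X³` equals
`((n-1)!/2) ((∑_{i=1}^{n-1} 1/i)² − ∑_{i=1}^{n-1} 1/i²)`. -/
theorem stirling_harmonic (n : ℕ) (hn : 2 ≤ n) :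
    (ascPochhammer ℚ n).coeff 2 =
        (Nat.factorial (n - 1) : ℚ) * ∑ i ∈ Finset.Icc 1 (n - 1), (1 : ℚ) / i ∧
    (ascPochhammer ℚ n).coeff 3 =
        ((Nat.factorial (n - 1) : ℚ) / 2) *
          ((∑ i ∈ Finset.Icc 1 (n - 1), (1 : ℚ) / i) ^ 2 -
            ∑ i ∈ Finset.Icc 1 (n - 1), (1 : ℚ) / (i : ℚ) ^ 2) := by
  obtain ⟨m, rfl⟩ : ∃ m, n = m + 1 := ⟨n - 1, by lia⟩
  exact ⟨ascPochhammer_succ_coeff_two m, ascPochhammer_succ_coeff_three m⟩
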